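/- Let n_min ≥ 1 and n_maj > n_min be integers. The minimax excess risk over the label shift class P_LS is lower bounded as: inf over all measurable algorithms A of sup over (P_maj, P_min) ∈ P_LS of ExcessRisk[A; (P_maj, P_min)] ≥ (1/600) · 1/n_min^{1/3}. -/

import Mathlib

open MeasureTheory Set
open scoped ENNReal Classical

noncomputable section

/-! ## Basic setup: distributions on `ℝ × Bool`, risk, excess risk.

A labelled example is a pair `(x, y) : ℝ × Bool`, where the label `true` codes `+1`
and `false` codes `-1`; features are supported on `[0,1]`. -/

/-- The risk (probability of misclassification) of a classifier `f : ℝ → Bool`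
under a distribution `P` on `ℝ × Bool`. -/
def risk (f : ℝ → Bool) (P : Measure (ℝ × Bool)) : ℝ :=
  (P {p : ℝ × Bool | f p.1 ≠ p.2}).toReal

/-- The Bayes risk of a distribution: the infimum of the risk over all classifiers. -/
def bayesRisk (P : Measure (ℝ × Bool)) : ℝ :=
  ⨅ f : ℝ → Bool, risk f P

/-- The balanced test distribution `P_test = (1/2) P_maj + (1/2) P_min`. -/
def testMeasure (Pmaj Pmin : Measure (ℝ × Bool)) : Measure (ℝ × Bool) :=
  (2 : ℝ≥0∞)⁻¹ • Pmaj + (2 : ℝ≥0∞)⁻¹ • Pmin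

/-- A training sample: `nmaj` labelled points from the majority distribution and
`nmin` labelled points from the minority distribution. -/
abbrev Sample (nmaj nmin : ℕ) : Type :=
  (Fin nmaj → ℝ × Bool) × (Fin nmin → ℝ × Bool)

/-- The law `P_maj^{n_maj} × P_min^{n_min}` of the training sample. -/
def sampleMeasure (nmaj nmin : ℕ) (Pmaj Pmin : Measure (ℝ × Bool)) :
    Measure (Sample nmaj nmin) :=
  (Measure.pi fun _ : Fin nmaj => Pmaj).prod (Measure.pi fun _ : Fin nmin => Pmin)

/-- An algorithm (a map from samples to classifiers) is measurable if the joint map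
`(S, x) ↦ A S x` is measurable. -/
def MeasurableAlg (nmaj nmin : ℕ) (A : Sample nmaj nmin → ℝ → Bool) : Prop :=
  Measurable fun p : Sample nmaj nmin × ℝ => A p.1 p.2

/-- The expected excess risk of the algorithm `A` on the pair `(P_maj, P_min)`:
`E_{S ~ P_maj^{n_maj} × P_min^{n_min}}[R(A^S; P_test)] - R(f^*; P_test)`. -/
def excessRisk (nmaj nmin : ℕ) (A : Sample nmaj nmin → ℝ → Bool)
    (Pmaj Pmin : Measure (ℝ × Bool)) : ℝ :=
  (∫ S, risk (A S) (testMeasure Pmaj Pmin) ∂sampleMeasure nmaj nmin Pmaj Pmin)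
    - bayesRisk (testMeasure Pmaj Pmin)

/-- The distribution on `ℝ × Bool` supported on label `y` whose feature has density `p`
(w.r.t. Lebesgue measure) on `[0,1]`. -/
def labelMeasure (p : ℝ → ℝ) (y : Bool) : Measure (ℝ × Bool) :=
  Measure.map (fun x => (x, y))
    ((volume.restrict (Icc (0:ℝ) 1)).withDensity fun x => ENNReal.ofReal (p x))

/-- The label-shift class `𝒫_LS`: `P_maj(x,y) = P₁(x)·1{y = 1}`,
`P_min(x,y) = P₋₁(x)·1{y = -1}` with `P₁, P₋₁` 1-Lipschitz densities on `[0,1]`. -/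
def memLS (Pmaj Pmin : Measure (ℝ × Bool)) : Prop :=
  ∃ p1 pm1 : ℝ → ℝ,
    (∀ x, 0 ≤ p1 x) ∧ (∀ x, 0 ≤ pm1 x) ∧
    LipschitzOnWith 1 p1 (Icc 0 1) ∧ LipschitzOnWith 1 pm1 (Icc 0 1) ∧
    (∫ x in Icc (0:ℝ) 1, p1 x) = 1 ∧ (∫ x in Icc (0:ℝ) 1, pm1 x) = 1 ∧
    Pmaj = labelMeasure p1 true ∧ Pmin = labelMeasure pm1 false

/-- Total variation distance between two densities on `[0,1]`:
`TV(p, q) = (1/2)∫₀¹ |p - q|`. -/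
def tvDist (p q : ℝ → ℝ) : ℝ :=
  (1/2) * ∫ x in Icc (0:ℝ) 1, |p x - q x|

/-- The distribution on `ℝ × Bool` whose feature has density `p` on `[0,1]` and whose
label is `true` with probability `η x` conditionally on the feature `x`. -/
def covMeasure (p η : ℝ → ℝ) : Measure (ℝ × Bool) :=
  labelMeasure (fun x => p x * η x) true + labelMeasure (fun x => p x * (1 - η x)) false

/-- The group-covariate shift class `𝒫_GS(τ)`: `P_maj(x,y) = P_a(x)·P(y|x)`,
`P_min(x,y) = P_b(x)·P(y|x)` with group densities `P_a, P_b` on `[0,1]`,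
a shared 1-Lipschitz conditional label distribution, and overlap
`1 - TV(P_a, P_b) ≥ τ`. -/
def memGS (τ : ℝ) (Pmaj Pmin : Measure (ℝ × Bool)) : Prop :=
  ∃ pa pb η : ℝ → ℝ,
    (∀ x, 0 ≤ pa x) ∧ (∀ x, 0 ≤ pb x) ∧
    (∫ x in Icc (0:ℝ) 1, pa x) = 1 ∧ (∫ x in Icc (0:ℝ) 1, pb x) = 1 ∧
    (∀ x, 0 ≤ η x ∧ η x ≤ 1) ∧
    LipschitzOnWith 1 η (Icc 0 1) ∧ LipschitzOnWith 1 (fun x => 1 - η x) (Icc 0 1) ∧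
    τ ≤ 1 - tvDist pa pb ∧
    Pmaj = covMeasure pa η ∧ Pmin = covMeasure pb η

/-! ## The hat function -/

/-- The hat function `φ_K`. -/
def hatFun (K : ℕ) (x : ℝ) : ℝ :=
  if x ∈ Icc (-(1/(2*(K:ℝ)))) 0 then |x + 1/(4*(K:ℝ))| - 1/(4*(K:ℝ))
  else if x ∈ Icc (0:ℝ) (1/(2*(K:ℝ))) then 1/(4*(K:ℝ)) - |x - 1/(4*(K:ℝ))|
  else 0

/-! ## The hard family for the label-shift lower bound.

Bins are 0-indexed: `I_j = [j/K, (j+1)/K)` for `j = 0, …, K-1`, corresponding to the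
paper's `I_{j+1} = [((j+1)-1)/K, (j+1)/K]`; the bin center is `(j + 1/2)/K`. -/

/-- The value in `{-1, 0, 1}` coded by an element of `Fin 3`. -/
def trit (i : Fin 3) : ℝ := (i : ℝ) - 1

/-- The perturbed density of the hard label-shift family: on the bin
`I_j = [j/K, (j+1)/K)` it equals `1 + v_j · φ_K(x - (j + 1/2)/K)`. -/
def hardDensityLS (K : ℕ) (v : Fin K → Fin 3) (x : ℝ) : ℝ :=
  1 + ∑ j : Fin K,
    (if x ∈ Ico ((j:ℝ)/(K:ℝ)) (((j:ℝ)+1)/(K:ℝ))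
      then trit (v j) * hatFun K (x - ((j:ℝ) + 1/2)/(K:ℝ)) else 0)

/-- The index set `𝒱 = {-1,0,1}^K × {-1,0,1}^K` of the hard label-shift family. -/
abbrev TritPair (K : ℕ) : Type := (Fin K → Fin 3) × (Fin K → Fin 3)

/-- The law `Q(S | v) = P_{v,maj}^{n_maj} × P_{v,min}^{n_min}` of the sample for the hard
label-shift instance indexed by `v`. -/
def hardLSMeasure (K nmaj nmin : ℕ) (v : TritPair K) : Measure (Sample nmaj nmin) :=
  sampleMeasure nmaj nmin (labelMeasure (hardDensityLS K v.1) true)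
    (labelMeasure (hardDensityLS K v.2) false)

/-- The marginal law `Q_S` of the sample when the index `V` is uniform on `𝒱`. -/
def hardLSMarginal (K nmaj nmin : ℕ) : Measure (Sample nmaj nmin) :=
  ∑ v : TritPair K, (Fintype.card (TritPair K) : ℝ≥0∞)⁻¹ • hardLSMeasure K nmaj nmin v

/-- The posterior weight `Q(v | S)`: the Radon–Nikodym derivative of
`(1/|𝒱|) · Q(S | v)` with respect to `Q_S`, evaluated at `S`. -/
def postLS (K nmaj nmin : ℕ) (v : TritPair K) (S : Sample nmaj nmin) : ℝ :=
  (((Fintype.card (TritPair K) : ℝ≥0∞)⁻¹ • hardLSMeasure K nmaj nmin v).rnDeriv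
      (hardLSMarginal K nmaj nmin) S).toReal

/-- The posterior mixture density `Σ_{v ∈ 𝒱} Q(v | S) · P_{v, ±1}`;
`cls = true` selects the class `+1` densities `P_{v,1}`. -/
def postMixLS (K nmaj nmin : ℕ) (S : Sample nmaj nmin) (cls : Bool) (x : ℝ) : ℝ :=
  ∑ v : TritPair K,
    postLS K nmaj nmin v S * hardDensityLS K (if cls then v.1 else v.2) x

/-! ## The hard family for the group-covariate shift lower bound -/

/-- The sign `+1` / `-1` coded by a Bool. -/
def sgnB (b : Bool) : ℝ := if b then 1 else -1

/-- `P_v(y = 1 | x)` for the hard group-shift family: on the bin `I_j = [j/K, (j+1)/K)` it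
equals `(1/2)(1 + v_j · φ_K(x - (j+1/2)/K))`. -/
def hardEta (K : ℕ) (v : Fin K → Bool) (x : ℝ) : ℝ :=
  (1/2) * (1 + ∑ j : Fin K,
    (if x ∈ Ico ((j:ℝ)/(K:ℝ)) (((j:ℝ)+1)/(K:ℝ))
      then sgnB (v j) * hatFun K (x - ((j:ℝ) + 1/2)/(K:ℝ)) else 0))

/-- The majority-group feature density: `2 - τ` on `[0, 1/2)` and `τ` on `[1/2, 1]`. -/
def hardPa (τ : ℝ) (x : ℝ) : ℝ := if x < 1/2 then 2 - τ else τ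

/-- The minority-group feature density `P_b = 2 - P_a`. -/
def hardPb (τ : ℝ) (x : ℝ) : ℝ := 2 - hardPa τ x

/-- The law `Q(S | v)` of the sample for the hard group-shift instance indexed by `v`. -/
def hardGSMeasure (K nmaj nmin : ℕ) (τ : ℝ) (v : Fin K → Bool) :
    Measure (Sample nmaj nmin) :=
  sampleMeasure nmaj nmin (covMeasure (hardPa τ) (hardEta K v))
    (covMeasure (hardPb τ) (hardEta K v))

/-- The conditional law `Q(S | v_j = b)` of the sample given the `j`-th coordinate of the
uniformly random index: the uniform mixture over all `v` with `v_j = b`. -/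
def condGS (K nmaj nmin : ℕ) (τ : ℝ) (j : Fin K) (b : Bool) :
    Measure (Sample nmaj nmin) :=
  ((Finset.univ.filter fun v : Fin K → Bool => v j = b).card : ℝ≥0∞)⁻¹ •
    ∑ v ∈ Finset.univ.filter (fun v : Fin K → Bool => v j = b),
      hardGSMeasure K nmaj nmin τ v

/-- The Kullback–Leibler divergence `KL(μ ‖ ν) = ∫ log (dμ/dν) dμ`. -/
def klDiv' {α : Type*} [MeasurableSpace α] (μ ν : Measure α) : ℝ :=
  ∫ x, Real.log ((μ.rnDeriv ν x).toReal) ∂μ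

/-! ## The undersampled binning estimator -/

/-- The prediction of the undersampled binning estimator on the bin `I_j = [j/K, (j+1)/K)`
(0-indexed), where `s ⊆ Fin nmaj` is the set of retained majority samples: predict `+1`
iff the samples of the undersampled dataset in the bin with label `+1` strictly
outnumber those with label `-1`. -/
def usbBinPred (nmaj nmin K : ℕ) (s : Finset (Fin nmaj)) (S : Sample nmaj nmin)
    (j : ℕ) : Bool :=
  decide
    ((s.filter fun i => (S.1 i).2 = false ∧
        (S.1 i).1 ∈ Ico ((j:ℝ)/(K:ℝ)) (((j:ℝ)+1)/(K:ℝ))).card +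
      (Finset.univ.filter fun i : Fin nmin => (S.2 i).2 = false ∧
        (S.2 i).1 ∈ Ico ((j:ℝ)/(K:ℝ)) (((j:ℝ)+1)/(K:ℝ))).card
      <
      (s.filter fun i => (S.1 i).2 = true ∧
        (S.1 i).1 ∈ Ico ((j:ℝ)/(K:ℝ)) (((j:ℝ)+1)/(K:ℝ))).card +
      (Finset.univ.filter fun i : Fin nmin => (S.2 i).2 = true ∧
        (S.2 i).1 ∈ Ico ((j:ℝ)/(K:ℝ)) (((j:ℝ)+1)/(K:ℝ))).card)

/-- The undersampled binning classifier `A_USB^{S,K}` with `K` bins, given the retained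
majority samples `s`: on each bin it predicts the majority label among the undersampled
data in that bin. -/
def usbClassifier (nmaj nmin K : ℕ) (s : Finset (Fin nmaj)) (S : Sample nmaj nmin) :
    ℝ → Bool :=
  fun x => usbBinPred nmaj nmin K s S (min ⌊x * (K:ℝ)⌋₊ (K - 1))

/-- The expected excess risk of the undersampled binning estimator with `K` bins, where the
`nmin` retained majority samples are drawn uniformly at random without replacement
(uniformly among all subsets of size `nmin`). -/
def usbExcessRisk (nmaj nmin K : ℕ) (Pmaj Pmin : Measure (ℝ × Bool)) : ℝ :=
  (∑ s ∈ Finset.powersetCard nmin (Finset.univ : Finset (Fin nmaj)),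
      ∫ S, risk (usbClassifier nmaj nmin K s S) (testMeasure Pmaj Pmin)
        ∂sampleMeasure nmaj nmin Pmaj Pmin)
    / ((Finset.powersetCard nmin (Finset.univ : Finset (Fin nmaj))).card : ℝ)
  - bayesRisk (testMeasure Pmaj Pmin)

/-- `q_{j,y} = P(y | x ∈ I_j)` for the 0-indexed bin `I_j = [j/K, (j+1)/K)`. -/
def qBin (P : Measure (ℝ × Bool)) (K j : ℕ) (y : Bool) : ℝ :=
  (P ((Ico ((j:ℝ)/(K:ℝ)) (((j:ℝ)+1)/(K:ℝ))) ×ˢ ({y} : Set Bool))).toReal /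
    (P ((Ico ((j:ℝ)/(K:ℝ)) (((j:ℝ)+1)/(K:ℝ))) ×ˢ (univ : Set Bool))).toReal

/-- The excess risk of the binning estimator in the bin `I_j`:
`R_j(A_USB^S) = q_{j, -A_j^S} - min{q_{j,1}, q_{j,-1}}`. -/
def binExcess (nmaj nmin K : ℕ) (s : Finset (Fin nmaj)) (S : Sample nmaj nmin)
    (P : Measure (ℝ × Bool)) (j : ℕ) : ℝ :=
  qBin P K j (!(usbBinPred nmaj nmin K s S j)) - min (qBin P K j true) (qBin P K j false)

/-- The binomial probability mass function `P[Bin(m, p) = k]`. -/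
def binomPMF (m : ℕ) (p : ℝ) (k : ℕ) : ℝ :=
  (m.choose k : ℝ) * p ^ k * (1 - p) ^ (m - k)

/-! ## Changing the law of a product sample -/

theorem isProbabilityMeasure_withDensity_ofReal {X : Type*} [MeasurableSpace X] {P : Measure X}
    {q : X → ℝ} (hq0 : ∀ x, 0 ≤ q x) (hqi : Integrable q P) (hq1 : ∫ x, q x ∂P = 1) :
    IsProbabilityMeasure (P.withDensity fun x => ENNReal.ofReal (q x)) := by
  constructor
  rw [withDensity_apply _ MeasurableSet.univ, Measure.restrict_univ,
    ← ofReal_integral_eq_lintegral_ofReal hqi (Filter.Eventually.of_forall hq0), hq1,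
    ENNReal.ofReal_one]

theorem pi_withDensity_ofReal {X : Type*} [MeasurableSpace X] {P : Measure X}
    [IsProbabilityMeasure P] {q : X → ℝ} (hq0 : ∀ x, 0 ≤ q x) (hqi : Integrable q P)
    (hq1 : ∫ x, q x ∂P = 1) (n : ℕ) :
    Measure.pi (fun _ : Fin n => P.withDensity fun x => ENNReal.ofReal (q x)) =
      (Measure.pi fun _ : Fin n => P).withDensity
        fun x => ENNReal.ofReal (∏ i, q (x i)) := by
  have := isProbabilityMeasure_withDensity_ofReal hq0 hqi hq1
  refine Measure.pi_eq fun s hs => ?_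
  rw [withDensity_apply _ (MeasurableSet.univ_pi hs), Measure.restrict_pi_pi,
    ← ofReal_integral_eq_lintegral_ofReal
      (Integrable.fintype_prod (f := fun _ => q) fun i => hqi.restrict)
      (Filter.Eventually.of_forall fun x => Finset.prod_nonneg fun i _ => hq0 _),
    integral_fintype_prod_eq_prod (f := fun _ => q),
    ENNReal.ofReal_prod_of_nonneg fun i _ => integral_nonneg hq0]
  refine Finset.prod_congr rfl fun i _ => ?_
  rw [withDensity_apply _ (hs i), ← ofReal_integral_eq_lintegral_ofReal hqi.restrict
    (Filter.Eventually.of_forall hq0)]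

/-- Tilting the law of one block of an i.i.d. sample by a likelihood ratio `q` changes the mean of
a statistic bounded by `B` by an amount controlled by the second moment of `q`. -/
theorem abs_integral_tilt_sub_le {X Y : Type*} [MeasurableSpace X] [MeasurableSpace Y]
    {P : Measure X} [IsProbabilityMeasure P] {M : Measure Y} [IsProbabilityMeasure M]
    {q : X → ℝ} (hqm : Measurable q) (hq0 : ∀ x, 0 ≤ q x) {C : ℝ} (hqC : ∀ x, q x ≤ C)
    (hq1 : ∫ x, q x ∂P = 1) {χ : ℝ} {n : ℕ} (hχ : (∫ x, q x ^ 2 ∂P) ^ n ≤ 1 + χ)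
    {g : Y × (Fin n → X) → ℝ} (hg : Measurable g) {B : ℝ} (hB : ∀ z, |g z| ≤ B)
    {s : ℝ} (hs : 0 < s) :
    |(∫ z, g z ∂M.prod (Measure.pi fun _ => P.withDensity fun x => ENNReal.ofReal (q x)))
      - ∫ z, g z ∂M.prod (Measure.pi fun _ => P)| ≤ B * ((s + χ / s) / 2) := by
  have hqb : ∀ x, ‖q x‖ ≤ C := fun x => by
    rw [Real.norm_of_nonneg (hq0 x)]; exact hqC x
  have hqi : Integrable q P := Integrable.of_bound hqm.aestronglyMeasurable C
    (Filter.Eventually.of_forall hqb)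
  have hq2i : Integrable (fun x => q x ^ 2) P :=
    Integrable.of_bound (hqm.pow_const 2).aestronglyMeasurable (C ^ 2)
      (Filter.Eventually.of_forall fun x => by
        rw [norm_pow]; exact pow_le_pow_left₀ (norm_nonneg _) (hqb x) 2)
  set ν := M.prod (Measure.pi fun _ : Fin n => P) with hν
  set L : Y × (Fin n → X) → ℝ := fun z => ∏ i, q (z.2 i) with hL
  have hLm : Measurable L := by fun_prop
  have hL0 : ∀ z, 0 ≤ L z := fun z => Finset.prod_nonneg fun i _ => hq0 _
  have hLi : Integrable L ν :=
    (Integrable.fintype_prod (f := fun _ : Fin n => q) fun i => hqi).comp_snd M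
  have hL2 : ∀ z, L z ^ 2 = ∏ i, q (z.2 i) ^ 2 := fun z => (Finset.prod_pow _ _ _).symm
  have hL2i : Integrable (fun z => L z ^ 2) ν := by
    simp_rw [hL2]
    exact (Integrable.fintype_prod (f := fun _ : Fin n => fun x => q x ^ 2)
      fun i => hq2i).comp_snd M
  have hLint : ∫ z, L z ∂ν = 1 := by
    rw [hν, integral_fun_snd (f := fun y : Fin n → X => ∏ i, q (y i)),
      integral_fintype_prod_eq_pow]
    simp [hq1]
  have hL2int : ∫ z, L z ^ 2 ∂ν ≤ 1 + χ := by
    simp_rw [hL2]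
    rw [hν, integral_fun_snd (f := fun y : Fin n → X => ∏ i, q (y i) ^ 2),
      integral_fintype_prod_eq_pow (f := fun x => q x ^ 2)]
    simpa using hχ
  have htilt : M.prod (Measure.pi fun _ => P.withDensity fun x => ENNReal.ofReal (q x)) =
      ν.withDensity fun z => ENNReal.ofReal (L z) := by
    rw [pi_withDensity_ofReal hq0 hqi hq1, prod_withDensity_right (by fun_prop)]
  have hgi : Integrable g ν := Integrable.of_bound hg.aestronglyMeasurable B
    (Filter.Eventually.of_forall hB)
  have hgLi : Integrable (fun z => L z * g z) ν :=
    hLi.mul_bdd hg.aestronglyMeasurable (Filter.Eventually.of_forall hB)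
  rw [htilt, integral_withDensity_eq_integral_toReal_smul (by fun_prop)
    (Filter.Eventually.of_forall fun _ => ENNReal.ofReal_lt_top)]
  simp_rw [ENNReal.toReal_ofReal (hL0 _), smul_eq_mul]
  rw [← integral_sub hgLi hgi]
  have hdom : ∀ z, ‖L z * g z - g z‖ ≤ B * ((s + (L z ^ 2 - 2 * L z + 1) / s) / 2) := by
    intro z
    have hsq : |L z - 1| ≤ (s + (L z ^ 2 - 2 * L z + 1) / s) / 2 := by
      rw [show L z ^ 2 - 2 * L z + 1 = |L z - 1| ^ 2 by rw [sq_abs]; ring,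
        show s + |L z - 1| ^ 2 / s = (s ^ 2 + |L z - 1| ^ 2) / s by field_simp, div_div,
        le_div_iff₀ (by positivity)]
      nlinarith [sq_nonneg (s - |L z - 1|)]
    rw [show L z * g z - g z = g z * (L z - 1) by ring, norm_mul]
    exact mul_le_mul (hB z) hsq (abs_nonneg _) ((abs_nonneg _).trans (hB z))
  have hI1 : Integrable (fun z => L z ^ 2 - 2 * L z) ν := hL2i.sub (hLi.const_mul 2)
  have hI2 : Integrable (fun z => L z ^ 2 - 2 * L z + 1) ν := hI1.add (integrable_const 1)
  have hI3 : Integrable (fun z => s + (L z ^ 2 - 2 * L z + 1) / s) ν :=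
    (integrable_const s).add (hI2.div_const s)
  refine (norm_integral_le_of_norm_le ((hI3.div_const 2).const_mul B)
    (Filter.Eventually.of_forall hdom)).trans ?_
  rw [integral_const_mul, integral_div, integral_add (integrable_const s) (hI2.div_const s),
    integral_div, integral_add hI1 (integrable_const 1), integral_sub hL2i (hLi.const_mul 2),
    integral_const_mul, hLint]
  obtain ⟨z⟩ : Nonempty (Y × (Fin n → X)) := nonempty_of_isProbabilityMeasure ν
  have hB0 : 0 ≤ B := (abs_nonneg _).trans (hB z)
  simp only [integral_const, probReal_univ, smul_eq_mul, one_mul]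
  gcongr
  linarith

/-! ## The bump functions and the perturbed densities -/

/-- An odd (about `1/2`) cubic bump supported on `[0,1]`. -/
def bump (t : ℝ) : ℝ :=
  max 0 (min t 1) * (1 - max 0 (min t 1)) * (1 - 2 * max 0 (min t 1))

theorem continuous_bump : Continuous bump := by
  unfold bump; fun_prop

theorem bump_of_nonpos {t : ℝ} (h : t ≤ 0) : bump t = 0 := by
  simp [bump, max_eq_left (min_le_of_left_le h : min t 1 ≤ 0)]

theorem bump_of_one_le {t : ℝ} (h : 1 ≤ t) : bump t = 0 := by
  simp [bump, min_eq_right h]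

theorem bump_of_mem {t : ℝ} (h : t ∈ Icc (0:ℝ) 1) : bump t = t * (1 - t) * (1 - 2 * t) := by
  simp [bump, min_eq_left h.2, max_eq_right h.1]

theorem abs_bump_le (t : ℝ) : |bump t| ≤ 1 / 10 := by
  have h0 : 0 ≤ max 0 (min t 1) := le_max_left _ _
  have h1 : max 0 (min t 1) ≤ 1 := max_le zero_le_one (min_le_right _ _)
  unfold bump
  generalize max 0 (min t 1) = c at h0 h1
  have hc : 0 ≤ c * (1 - c) := mul_nonneg h0 (by linarith)
  rw [← sq_le_sq₀ (abs_nonneg _) (by norm_num), sq_abs]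
  have hu : c * (1 - c) ≤ 1 / 4 := by nlinarith [sq_nonneg (c - 1 / 2)]
  have key : (c * (1 - c) * (1 - 2 * c)) ^ 2 = (c * (1 - c)) ^ 2 * (1 - 4 * (c * (1 - c))) := by
    ring
  rw [key]
  generalize c * (1 - c) = u at hc hu
  nlinarith [mul_nonneg (add_nonneg hc (by norm_num : (0:ℝ) ≤ 1 / 12)) (sq_nonneg (u - 1 / 6))]

theorem abs_bump_sub_le (x y : ℝ) :
    |bump x - bump y| ≤ |max 0 (min x 1) - max 0 (min y 1)| := by
  have h0 : ∀ t : ℝ, 0 ≤ max 0 (min t 1) := fun t => le_max_left _ _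
  have h1 : ∀ t : ℝ, max 0 (min t 1) ≤ 1 := fun t => max_le zero_le_one (min_le_right _ _)
  unfold bump
  have hx0 := h0 x
  have hx1 := h1 x
  have hy0 := h0 y
  have hy1 := h1 y
  generalize max 0 (min x 1) = a at hx0 hx1
  generalize max 0 (min y 1) = b at hy0 hy1
  rw [show a * (1 - a) * (1 - 2 * a) - b * (1 - b) * (1 - 2 * b) =
    (a - b) * (1 - 3 * (a + b) + 2 * (a ^ 2 + a * b + b ^ 2)) by ring, abs_mul]
  refine mul_le_of_le_one_right (abs_nonneg _) (abs_le.2 ⟨?_, ?_⟩)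
  · nlinarith [sq_nonneg (a - b), sq_nonneg (a + b - 1)]
  · nlinarith [mul_nonneg hx0 (sub_nonneg.2 hx1), mul_nonneg hy0 (sub_nonneg.2 hy1),
      mul_nonneg hx0 (sub_nonneg.2 hy1), mul_nonneg hy0 (sub_nonneg.2 hx1)]

theorem integral_bump : ∫ t in (0:ℝ)..1, bump t = 0 := by
  have : ∫ t in (0:ℝ)..1, bump t = ∫ t in (0:ℝ)..1, (t - 3 * t ^ 2 + 2 * t ^ 3) := by
    refine intervalIntegral.integral_congr fun t ht => ?_
    rw [uIcc_of_le zero_le_one] at ht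
    simp only [bump_of_mem ht]; ring
  rw [this]
  simp (disch := exact Continuous.intervalIntegrable (by fun_prop) _ _) only
    [intervalIntegral.integral_add, intervalIntegral.integral_sub,
    intervalIntegral.integral_const_mul, integral_pow, integral_id]
  norm_num

theorem integral_bump_sq : ∫ t in (0:ℝ)..1, bump t ^ 2 = 1 / 210 := by
  have : ∫ t in (0:ℝ)..1, bump t ^ 2 =
      ∫ t in (0:ℝ)..1, (t ^ 2 - 6 * t ^ 3 + 13 * t ^ 4 - 12 * t ^ 5 + 4 * t ^ 6) := by
    refine intervalIntegral.integral_congr fun t ht => ?_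
    rw [uIcc_of_le zero_le_one] at ht
    simp only [bump_of_mem ht]; ring
  rw [this]
  simp (disch := exact Continuous.intervalIntegrable (by fun_prop) _ _) only
    [intervalIntegral.integral_add, intervalIntegral.integral_sub,
    intervalIntegral.integral_const_mul, integral_pow]
  norm_num

/-- The bump rescaled to the `j`-th of `K` bins. -/
def binBump (K j : ℕ) (x : ℝ) : ℝ := bump (K * x - j) / K

theorem continuous_binBump (K j : ℕ) : Continuous (binBump K j) := by
  unfold binBump
  have := continuous_bump
  fun_prop

theorem abs_binBump_le (K j : ℕ) (x : ℝ) : |binBump K j x| ≤ 1 / (10 * K) := by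
  rw [binBump, abs_div, Nat.abs_cast, ← div_div]
  gcongr
  exact abs_bump_le _

theorem binBump_mul_of_ne (K : ℕ) {i j : ℕ} (h : i ≠ j) (x : ℝ) :
    binBump K i x * binBump K j x = 0 := by
  unfold binBump
  rw [div_mul_div_comm]
  have : bump (K * x - i) * bump (K * x - j) = 0 := by
    rcases le_or_gt (K * x - i) 0 with h1 | h1
    · rw [bump_of_nonpos h1, zero_mul]
    rcases le_or_gt 1 (K * x - i) with h2 | h2
    · rw [bump_of_one_le h2, zero_mul]
    rcases lt_or_gt_of_ne h with h3 | h3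
    · have h4 : (i : ℝ) + 1 ≤ j := by exact_mod_cast h3
      rw [bump_of_nonpos (t := K * x - j) (by linarith), mul_zero]
    · have h4 : (j : ℝ) + 1 ≤ i := by exact_mod_cast h3
      rw [bump_of_one_le (t := K * x - j) (by linarith), mul_zero]
  rw [this, zero_div]

theorem integral_comp_bump {K j : ℕ} (hj : j < K) {F : ℝ → ℝ} (hF : Continuous F)
    (hF0 : F 0 = 0) :
    ∫ x in Icc (0:ℝ) 1, F (bump (K * x - j)) = (∫ t in (0:ℝ)..1, F (bump t)) / K := by
  have hK : (0:ℝ) < K := by exact_mod_cast (Nat.zero_le j).trans_lt hj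
  have hjK : (j:ℝ) + 1 ≤ K := by exact_mod_cast hj
  have hc : Continuous fun t => F (bump t) := hF.comp continuous_bump
  have hz : ∀ a b : ℝ, (∀ t ∈ uIcc a b, bump t = 0) → ∫ t in a..b, F (bump t) = 0 := by
    intro a b h
    rw [intervalIntegral.integral_congr (g := fun _ => 0) fun t ht => by simp [h t ht, hF0]]
    simp
  rw [integral_Icc_eq_integral_Ioc, ← intervalIntegral.integral_of_le zero_le_one,
    intervalIntegral.integral_comp_mul_sub (fun t => F (bump t)) hK.ne',
    ← intervalIntegral.integral_add_adjacent_intervals (b := 0) (hc.intervalIntegrable _ _)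
      (hc.intervalIntegrable _ _),
    ← intervalIntegral.integral_add_adjacent_intervals (a := 0) (b := 1)
      (hc.intervalIntegrable _ _) (hc.intervalIntegrable _ _), hz _ 0, hz 1 _]
  · simp [div_eq_inv_mul]
  · intro t ht
    rw [uIcc_of_le (by linarith)] at ht
    exact bump_of_one_le ht.1
  · intro t ht
    rw [uIcc_of_le (by simp)] at ht
    exact bump_of_nonpos ht.2

theorem integral_binBump {K j : ℕ} (hj : j < K) : ∫ x in Icc (0:ℝ) 1, binBump K j x = 0 := by
  unfold binBump
  rw [integral_div, integral_comp_bump hj (F := fun t => t) continuous_id rfl, integral_bump]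
  simp

theorem integral_binBump_sq {K j : ℕ} (hj : j < K) :
    ∫ x in Icc (0:ℝ) 1, binBump K j x ^ 2 = 1 / (210 * (K:ℝ) ^ 3) := by
  unfold binBump
  simp_rw [div_pow]
  rw [integral_div, integral_comp_bump hj (F := fun t => t ^ 2) (by fun_prop) (by simp),
    integral_bump_sq]
  have hK : (K:ℝ) ≠ 0 := by exact_mod_cast ((Nat.zero_le j).trans_lt hj).ne'
  field_simp

theorem integral_abs_binBump_le {K j : ℕ} (hj : j < K) :
    ∫ x in Icc (0:ℝ) 1, |binBump K j x| ≤ 1 / (10 * (K:ℝ) ^ 2) := by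
  have hK : (0:ℝ) < K := by exact_mod_cast (Nat.zero_le j).trans_lt hj
  unfold binBump
  simp_rw [abs_div, Nat.abs_cast]
  rw [integral_div, integral_comp_bump hj (F := fun t => |t|) (by fun_prop) (by simp)]
  have h : ∫ t in (0:ℝ)..1, |bump t| ≤ ∫ t in (0:ℝ)..1, (1 / 10 : ℝ) :=
    intervalIntegral.integral_mono_on zero_le_one
      ((continuous_bump.abs).intervalIntegrable _ _) (by simp) fun t _ => abs_bump_le t
  simp only [intervalIntegral.integral_const, sub_zero, one_smul] at h
  rw [div_div, ← sq, ← div_div]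
  gcongr

theorem sum_abs_binBump_sub_le (K : ℕ) {x y : ℝ} (hxy : x ≤ y) :
    ∑ j : Fin K, |binBump K j x - binBump K j y| ≤ y - x := by
  rcases Nat.eq_zero_or_pos K with rfl | hK0
  · simpa using hxy
  have hK : (0:ℝ) < K := by exact_mod_cast hK0
  have hclamp : ∀ (j : ℕ) (t : ℝ), max 0 (min (t - j) 1) =
      min t ((j + 1 : ℕ) : ℝ) - min t (j : ℝ) := by
    intro j t
    push_cast
    rcases le_total t j with h | h
    · rw [min_eq_left h, min_eq_left (by linarith), min_eq_left (by linarith),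
        max_eq_left (by linarith), sub_self]
    · rw [min_eq_right h]
      rcases le_total t (j + 1) with h' | h'
      · rw [min_eq_left h', min_eq_left (by linarith), max_eq_right (by linarith)]
      · rw [min_eq_right h', min_eq_right (by linarith)]; simp
  have hle : K * x ≤ K * y := by gcongr
  have hterm : ∀ j : Fin K, |binBump K j x - binBump K j y| ≤
      ((min (K * y) (((j:ℕ) + 1 : ℕ) : ℝ) - min (K * x) (((j:ℕ) + 1 : ℕ) : ℝ))
        - (min (K * y) ((j:ℕ) : ℝ) - min (K * x) ((j:ℕ) : ℝ))) / K := by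
    intro j
    rw [binBump, binBump, ← sub_div, abs_div, Nat.abs_cast]
    gcongr
    refine (abs_bump_sub_le _ _).trans ?_
    have hmono : max 0 (min (K * x - (j:ℕ)) 1) ≤ max 0 (min (K * y - (j:ℕ)) 1) := by gcongr
    rw [abs_sub_comm, abs_of_nonneg (by linarith), hclamp, hclamp]
    linarith
  refine (Finset.sum_le_sum fun j _ => hterm j).trans ?_
  rw [Fin.sum_univ_eq_sum_range (fun j => ((min (K * y) ((j + 1 : ℕ) : ℝ)
      - min (K * x) ((j + 1 : ℕ) : ℝ)) - (min (K * y) (j : ℝ) - min (K * x) (j : ℝ))) / (K:ℝ)) K,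
    ← Finset.sum_div, Finset.sum_range_sub
      (fun j : ℕ => min (K * y) (j : ℝ) - min (K * x) (j : ℝ)), div_le_iff₀ hK]
  rw [Nat.cast_zero]
  simp only [min_def]
  split_ifs <;> linarith

/-- The perturbation with amplitude `w j` on the `j`-th bin. -/
def perturbation (K : ℕ) (w : Fin K → ℝ) (x : ℝ) : ℝ := ∑ j : Fin K, w j * binBump K j x

theorem continuous_perturbation (K : ℕ) (w : Fin K → ℝ) : Continuous (perturbation K w) := by
  unfold perturbation
  have := continuous_binBump K
  fun_prop

theorem perturbation_mul_binBump {K : ℕ} (w : Fin K → ℝ) (j : Fin K) (x : ℝ) :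
    perturbation K w x * binBump K j x = w j * binBump K j x ^ 2 := by
  rw [perturbation, Finset.sum_mul, Finset.sum_eq_single j]
  · ring
  · intro i _ hij
    rw [mul_assoc, binBump_mul_of_ne K (Fin.val_ne_of_ne hij), mul_zero]
  · simp

theorem perturbation_sq {K : ℕ} (w : Fin K → ℝ) (x : ℝ) :
    perturbation K w x ^ 2 = ∑ j : Fin K, w j ^ 2 * binBump K j x ^ 2 := by
  rw [sq]
  nth_rewrite 2 [perturbation]
  rw [Finset.mul_sum]
  refine Finset.sum_congr rfl fun j _ => ?_
  rw [mul_left_comm, perturbation_mul_binBump]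
  ring

theorem abs_perturbation_le {K : ℕ} {w : Fin K → ℝ} (hw : ∀ j, |w j| ≤ 1) (x : ℝ) :
    |perturbation K w x| ≤ 1 / (10 * K) := by
  by_cases h : ∃ j : Fin K, binBump K j x ≠ 0
  · obtain ⟨j, hj⟩ := h
    have : perturbation K w x = w j * binBump K j x := by
      apply mul_right_cancel₀ hj
      rw [perturbation_mul_binBump]
      ring
    rw [this, abs_mul]
    exact (mul_le_of_le_one_left (abs_nonneg _) (hw j)).trans (abs_binBump_le K j x)
  · push Not at h
    have : perturbation K w x = 0 := Finset.sum_eq_zero fun j _ => by rw [h j, mul_zero]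
    rw [this, abs_zero]
    positivity

theorem abs_perturbation_le_one {K : ℕ} {w : Fin K → ℝ} (hw : ∀ j, |w j| ≤ 1) (x : ℝ) :
    |perturbation K w x| ≤ 1 := by
  refine (abs_perturbation_le hw x).trans ?_
  rcases Nat.eq_zero_or_pos K with rfl | hK
  · simp
  · have : (1:ℝ) ≤ K := by exact_mod_cast hK
    rw [div_le_one (by positivity)]
    linarith

theorem lipschitzWith_perturbation {K : ℕ} {w : Fin K → ℝ} (hw : ∀ j, |w j| ≤ 1) :
    LipschitzWith 1 (perturbation K w) := by
  have key : ∀ x y, x ≤ y → |perturbation K w x - perturbation K w y| ≤ y - x := by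
    intro x y hxy
    refine le_trans ?_ (sum_abs_binBump_sub_le K hxy)
    rw [perturbation, perturbation, ← Finset.sum_sub_distrib]
    refine (Finset.abs_sum_le_sum_abs _ _).trans (Finset.sum_le_sum fun j _ => ?_)
    rw [← mul_sub, abs_mul]
    exact mul_le_of_le_one_left (abs_nonneg _) (hw j)
  refine LipschitzWith.of_dist_le_mul fun x y => ?_
  rw [Real.dist_eq, Real.dist_eq, NNReal.coe_one, one_mul]
  rcases le_total x y with h | h
  · rw [abs_sub_comm x y, abs_of_nonneg (sub_nonneg.2 h)]
    exact key x y h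
  · rw [abs_sub_comm, abs_of_nonneg (sub_nonneg.2 h)]
    exact key y x h

theorem integrableOn_of_continuous {f : ℝ → ℝ} (hf : Continuous f) :
    Integrable f (volume.restrict (Icc (0:ℝ) 1)) :=
  hf.continuousOn.integrableOn_Icc

theorem integral_perturbation {K : ℕ} (w : Fin K → ℝ) :
    ∫ x in Icc (0:ℝ) 1, perturbation K w x = 0 := by
  unfold perturbation
  rw [integral_finsetSum _ fun (j : Fin K) _ =>
    integrableOn_of_continuous ((continuous_binBump K j).const_mul (w j))]
  exact Finset.sum_eq_zero fun j _ => by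
    rw [integral_const_mul, integral_binBump j.isLt, mul_zero]

theorem integral_perturbation_sq {K : ℕ} (hK : 0 < K) {w : Fin K → ℝ} (hw : ∀ j, |w j| = 1) :
    ∫ x in Icc (0:ℝ) 1, perturbation K w x ^ 2 = 1 / (210 * (K:ℝ) ^ 2) := by
  have hw2 : ∀ j, w j ^ 2 = 1 := fun j => by rw [← sq_abs, hw, one_pow]
  simp_rw [perturbation_sq, hw2, one_mul]
  rw [integral_finsetSum (f := fun (j : Fin K) x => binBump K j x ^ 2) _ fun (j : Fin K) _ =>
    integrableOn_of_continuous ((continuous_binBump K j).pow 2)]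
  simp_rw [fun j : Fin K => integral_binBump_sq j.isLt]
  have : (K:ℝ) ≠ 0 := by exact_mod_cast hK.ne'
  simp only [Finset.sum_const, Finset.card_univ, Fintype.card_fin, nsmul_eq_mul]
  field_simp

/-- The perturbed uniform density. -/
def perturbedDensity (K : ℕ) (w : Fin K → ℝ) (x : ℝ) : ℝ := 1 + perturbation K w x

theorem continuous_perturbedDensity (K : ℕ) (w : Fin K → ℝ) :
    Continuous (perturbedDensity K w) :=
  continuous_const.add (continuous_perturbation K w)

theorem perturbedDensity_nonneg {K : ℕ} {w : Fin K → ℝ} (hw : ∀ j, |w j| ≤ 1) (x : ℝ) :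
    0 ≤ perturbedDensity K w x := by
  have := (abs_le.1 (abs_perturbation_le_one hw x)).1
  unfold perturbedDensity
  linarith

theorem integral_perturbedDensity {K : ℕ} (w : Fin K → ℝ) :
    ∫ x in Icc (0:ℝ) 1, perturbedDensity K w x = 1 := by
  unfold perturbedDensity
  rw [integral_add (integrable_const 1) (integrableOn_of_continuous (continuous_perturbation K w)),
    integral_perturbation]
  simp

theorem perturbedDensity_eq_update_mul {K : ℕ} (w : Fin K → ℝ) (j : Fin K) (x : ℝ) :
    perturbedDensity K w x =
      perturbedDensity K (Function.update w j 0) x * (1 + w j * binBump K j x) := by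
  have h0 : perturbation K (Function.update w j 0) x * binBump K j x = 0 := by
    rw [perturbation_mul_binBump, Function.update_self, zero_mul]
  have h1 : perturbation K w x =
      perturbation K (Function.update w j 0) x + w j * binBump K j x := by
    have hrest : ∑ i ∈ Finset.univ.erase j, Function.update w j 0 i * binBump K i x =
        ∑ i ∈ Finset.univ.erase j, w i * binBump K i x :=
      Finset.sum_congr rfl fun i hi => by
        rw [Function.update_of_ne (Finset.ne_of_mem_erase hi)]
    unfold perturbation
    rw [← Finset.add_sum_erase _ _ (Finset.mem_univ j),
      ← Finset.add_sum_erase _ (fun i : Fin K => Function.update w j 0 i * binBump K i x)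
        (Finset.mem_univ j), Function.update_self, hrest]
    ring
  unfold perturbedDensity
  rw [h1]
  linear_combination (-w j) * h0

/-! ## Label measures and risks -/

theorem measurable_prodMk_label (y : Bool) : Measurable fun x : ℝ => (x, y) :=
  measurable_id.prodMk measurable_const

theorem integral_labelMeasure {p : ℝ → ℝ} (hp : Measurable p) (hp0 : ∀ x, 0 ≤ p x) (y : Bool)
    {g : ℝ × Bool → ℝ} (hg : Measurable g) :
    ∫ z, g z ∂labelMeasure p y = ∫ x in Icc (0:ℝ) 1, p x * g (x, y) := by
  rw [labelMeasure, integral_map (measurable_prodMk_label y).aemeasurable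
    hg.aestronglyMeasurable, integral_withDensity_eq_integral_toReal_smul (by fun_prop)
    (Filter.Eventually.of_forall fun _ => ENNReal.ofReal_lt_top)]
  simp_rw [ENNReal.toReal_ofReal (hp0 _), smul_eq_mul]

theorem labelMeasure_mul {p g : ℝ → ℝ} (hp : Measurable p) (hp0 : ∀ x, 0 ≤ p x)
    (hg : Measurable g) (y : Bool) :
    labelMeasure (fun x => p x * g x) y =
      (labelMeasure p y).withDensity fun z => ENNReal.ofReal (g z.1) := by
  have hm := measurable_prodMk_label y
  ext s hs
  rw [withDensity_apply _ hs, labelMeasure, labelMeasure, Measure.map_apply hm hs,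
    setLIntegral_map hs (by fun_prop) hm, withDensity_apply _ (hm hs),
    setLIntegral_withDensity_eq_setLIntegral_mul _ (by fun_prop) (by fun_prop) (hm hs)]
  simp_rw [ENNReal.ofReal_mul (hp0 _)]
  rfl

theorem isProbabilityMeasure_labelMeasure {p : ℝ → ℝ} (hp0 : ∀ x, 0 ≤ p x)
    (hp1 : ∫ x in Icc (0:ℝ) 1, p x = 1) (y : Bool) :
    IsProbabilityMeasure (labelMeasure p y) := by
  have hi : Integrable p (volume.restrict (Icc (0:ℝ) 1)) := by
    by_contra h
    rw [integral_undef h] at hp1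
    exact zero_ne_one hp1
  have := isProbabilityMeasure_withDensity_ofReal hp0 hi hp1
  exact Measure.isProbabilityMeasure_map (measurable_prodMk_label y).aemeasurable

theorem risk_testMeasure {p : ℝ → ℝ} (hp : Continuous p) (hp0 : ∀ x, 0 ≤ p x)
    (hp1 : ∫ x in Icc (0:ℝ) 1, p x = 1) {f : ℝ → Bool} (hf : Measurable f) :
    risk f (testMeasure (labelMeasure (fun _ => 1) true) (labelMeasure p false)) =
      (1 / 2) * (1 + ∫ x in Icc (0:ℝ) 1, if f x = true then p x - 1 else 0) := by
  have hT : MeasurableSet {x | f x = true} := hf (measurableSet_singleton true)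
  have hS : MeasurableSet {q : ℝ × Bool | f q.1 ≠ q.2} :=
    (measurableSet_eq_fun (hf.comp measurable_fst) measurable_snd).compl
  have h1 := isProbabilityMeasure_labelMeasure (p := fun _ => 1) (fun _ => zero_le_one)
    (by simp) true
  have h2 := isProbabilityMeasure_labelMeasure hp0 hp1 false
  have hreal : ∀ (r : ℝ → ℝ) (y : Bool), Measurable r → (∀ x, 0 ≤ r x) →
      (labelMeasure r y {q : ℝ × Bool | f q.1 ≠ q.2}).toReal =
        ∫ x in Icc (0:ℝ) 1, if f x ≠ y then r x else 0 := by
    intro r y hr hr0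
    have := integral_labelMeasure hr hr0 y
      (g := {q : ℝ × Bool | f q.1 ≠ q.2}.indicator 1) (measurable_one.indicator hS)
    rw [integral_indicator_one hS] at this
    rw [← measureReal_def, this]
    refine integral_congr_ae (Filter.Eventually.of_forall fun x => ?_)
    by_cases h : f x = y <;> simp [h]
  have hint : ∀ r : ℝ → ℝ, Continuous r →
      Integrable (fun x => if f x = true then r x else 0) (volume.restrict (Icc (0:ℝ) 1)) :=
    fun r hr => ((integrableOn_of_continuous hr).indicator hT).congr
      (Filter.Eventually.of_forall fun x => by simp [indicator])
  rw [risk, testMeasure, Measure.add_apply, Measure.smul_apply, Measure.smul_apply, smul_eq_mul,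
    smul_eq_mul, ENNReal.toReal_add (by finiteness) (by finiteness), ENNReal.toReal_mul,
    ENNReal.toReal_mul, hreal _ _ measurable_const fun _ => zero_le_one,
    hreal _ _ hp.measurable hp0]
  have e1 : ∫ x in Icc (0:ℝ) 1, (if f x ≠ true then (1:ℝ) else 0) =
      1 - ∫ x in Icc (0:ℝ) 1, if f x = true then (1:ℝ) else 0 := by
    trans (∫ x in Icc (0:ℝ) 1, (1:ℝ)) - ∫ x in Icc (0:ℝ) 1, if f x = true then (1:ℝ) else 0
    swap
    · simp
    rw [← integral_sub (integrable_const _) (hint _ continuous_const)]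
    refine integral_congr_ae (Filter.Eventually.of_forall fun x => ?_)
    by_cases h : f x = true <;> simp [h]
  have e2 : ∫ x in Icc (0:ℝ) 1, (if f x = true then p x - 1 else 0) =
      (∫ x in Icc (0:ℝ) 1, if f x = true then p x else 0) -
        ∫ x in Icc (0:ℝ) 1, if f x = true then (1:ℝ) else 0 := by
    rw [← integral_sub (hint _ hp) (hint _ continuous_const)]
    refine integral_congr_ae (Filter.Eventually.of_forall fun x => ?_)
    by_cases h : f x = true <;> simp [h]
  rw [e1, e2]
  simp only [ne_eq, Bool.not_eq_false]
  rw [ENNReal.toReal_inv, ENNReal.toReal_ofNat]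
  ring

theorem bayesRisk_nonneg (P : Measure (ℝ × Bool)) : 0 ≤ bayesRisk P :=
  Real.iInf_nonneg fun _ => ENNReal.toReal_nonneg

theorem bayesRisk_le_risk (P : Measure (ℝ × Bool)) (f : ℝ → Bool) : bayesRisk P ≤ risk f P :=
  ciInf_le ⟨0, by rintro _ ⟨f, rfl⟩; exact ENNReal.toReal_nonneg⟩ f

theorem bayesRisk_perturbed_le {K : ℕ} (hK : 0 < K) {w : Fin K → ℝ} (hw : ∀ j, |w j| = 1) :
    bayesRisk (testMeasure (labelMeasure (fun _ => 1) true)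
      (labelMeasure (perturbedDensity K w) false)) ≤ (1 / 2) * (1 - 1 / (42 * K)) := by
  have hw' : ∀ j, |w j| ≤ 1 := fun j => (hw j).le
  have hKr : (0:ℝ) < K := by exact_mod_cast hK
  have hc := continuous_perturbation K w
  have hT : MeasurableSet {x | perturbation K w x < 0} :=
    measurableSet_lt hc.measurable measurable_const
  have hf : Measurable fun x => decide (perturbation K w x < 0) :=
    measurable_to_bool (by simpa [preimage] using hT)
  refine (bayesRisk_le_risk _ fun x => decide (perturbation K w x < 0)).trans ?_
  rw [risk_testMeasure (continuous_perturbedDensity K w) (perturbedDensity_nonneg hw')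
    (integral_perturbedDensity w) hf]
  have hle : ∫ x in Icc (0:ℝ) 1, (if decide (perturbation K w x < 0) = true
        then perturbedDensity K w x - 1 else 0) ≤
      ∫ x in Icc (0:ℝ) 1, (1 / 2) * (perturbation K w x - 10 * K * perturbation K w x ^ 2) := by
    refine integral_mono ?_ (integrableOn_of_continuous (by fun_prop)) fun x => ?_
    · simp only [decide_eq_true_eq]
      exact (integrableOn_of_continuous
        ((continuous_perturbedDensity K w).sub continuous_const)).indicator hT
    · have hb := abs_perturbation_le hw' x
      have hsq : 10 * K * perturbation K w x ^ 2 ≤ |perturbation K w x| := by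
        rw [← sq_abs, sq, ← mul_assoc]
        refine mul_le_of_le_one_left (abs_nonneg _) ?_
        rw [le_div_iff₀ (by positivity)] at hb
        linarith
      simp only [decide_eq_true_eq, perturbedDensity]
      split_ifs with h
      · rw [abs_of_neg h] at hsq
        linarith
      · rw [abs_of_nonneg (not_lt.1 h)] at hsq
        linarith
  rw [integral_const_mul, integral_sub (integrableOn_of_continuous hc)
    (integrableOn_of_continuous (by fun_prop)), integral_const_mul, integral_perturbation,
    integral_perturbation_sq hK hw] at hle
  have : (1 / 2 : ℝ) * (0 - 10 * K * (1 / (210 * (K:ℝ) ^ 2))) = - (1 / (42 * K)) := by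
    field_simp
    norm_num
  linarith

/-! ## The pair of laws indexed by a vector of amplitudes -/

theorem memLS_perturbed {K : ℕ} {w : Fin K → ℝ} (hw : ∀ j, |w j| ≤ 1) :
    memLS (labelMeasure (fun _ => 1) true) (labelMeasure (perturbedDensity K w) false) := by
  refine ⟨fun _ => 1, perturbedDensity K w, fun _ => zero_le_one, perturbedDensity_nonneg hw,
    ((LipschitzWith.const (1:ℝ)).weaken zero_le_one).lipschitzOnWith, ?_, by simp, integral_perturbedDensity w, rfl, rfl⟩
  refine LipschitzWith.lipschitzOnWith (LipschitzWith.of_dist_le_mul fun x y => ?_)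
  unfold perturbedDensity
  rw [dist_add_left]
  exact (lipschitzWith_perturbation hw).dist_le_mul x y

theorem isProbabilityMeasure_perturbed {K : ℕ} {w : Fin K → ℝ} (hw : ∀ j, |w j| ≤ 1) :
    IsProbabilityMeasure (labelMeasure (perturbedDensity K w) false) :=
  isProbabilityMeasure_labelMeasure (perturbedDensity_nonneg hw) (integral_perturbedDensity w) _

instance isProbabilityMeasure_uniform :
    IsProbabilityMeasure (labelMeasure (fun _ => 1) true) :=
  isProbabilityMeasure_labelMeasure (fun _ => zero_le_one) (by simp) _

/-- The law of the sample when the majority features are uniform and the minority density has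
amplitudes `w`. -/
def perturbedSample (K nmaj nmin : ℕ) (w : Fin K → ℝ) : Measure (Sample nmaj nmin) :=
  sampleMeasure nmaj nmin (labelMeasure (fun _ => 1) true)
    (labelMeasure (perturbedDensity K w) false)

/-- The mass that the `j`-th bump puts on the region where the learned classifier predicts
`true`. -/
def bumpScore {nmaj nmin : ℕ} (A : Sample nmaj nmin → ℝ → Bool) (K j : ℕ)
    (S : Sample nmaj nmin) : ℝ :=
  ∫ x in Icc (0:ℝ) 1, if A S x = true then binBump K j x else 0

theorem abs_bumpScore_le {nmaj nmin : ℕ} (A : Sample nmaj nmin → ℝ → Bool) {K j : ℕ}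
    (hj : j < K) (S : Sample nmaj nmin) : |bumpScore A K j S| ≤ 1 / (10 * (K:ℝ) ^ 2) := by
  have h := norm_integral_le_of_norm_le (f := fun x => if A S x = true then binBump K j x else 0)
    (integrableOn_of_continuous (continuous_binBump K j).abs)
    (Filter.Eventually.of_forall fun x => ?_)
  · exact h.trans (integral_abs_binBump_le hj)
  split_ifs
  · rfl
  · simp

theorem measurable_bumpScore {nmaj nmin : ℕ} {A : Sample nmaj nmin → ℝ → Bool}
    (hA : MeasurableAlg nmaj nmin A) (K j : ℕ) : Measurable (bumpScore A K j) := by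
  have h : Measurable fun p : Sample nmaj nmin × ℝ =>
      if A p.1 p.2 = true then binBump K j p.2 else 0 :=
    Measurable.ite (hA (measurableSet_singleton true))
      ((continuous_binBump K j).measurable.comp measurable_snd) measurable_const
  exact (h.stronglyMeasurable.integral_prod_right').measurable

theorem integrable_bumpScore {nmaj nmin : ℕ} {A : Sample nmaj nmin → ℝ → Bool}
    (hA : MeasurableAlg nmaj nmin A) {K j : ℕ} (hj : j < K) (μ : Measure (Sample nmaj nmin))
    [IsProbabilityMeasure μ] : Integrable (bumpScore A K j) μ :=
  Integrable.of_bound (measurable_bumpScore hA K j).aestronglyMeasurable _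
    (Filter.Eventually.of_forall (abs_bumpScore_le A hj))

theorem isProbabilityMeasure_perturbedSample {K : ℕ} (nmaj nmin : ℕ) {w : Fin K → ℝ}
    (hw : ∀ j, |w j| ≤ 1) : IsProbabilityMeasure (perturbedSample K nmaj nmin w) := by
  have := isProbabilityMeasure_perturbed hw
  unfold perturbedSample sampleMeasure
  infer_instance

theorem MeasurableAlg.measurable_apply {nmaj nmin : ℕ} {A : Sample nmaj nmin → ℝ → Bool}
    (hA : MeasurableAlg nmaj nmin A) (S : Sample nmaj nmin) : Measurable (A S) :=
  Measurable.comp (g := fun p : Sample nmaj nmin × ℝ => A p.1 p.2) hA measurable_prodMk_left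

theorem risk_perturbed {nmaj nmin : ℕ} {A : Sample nmaj nmin → ℝ → Bool}
    (hA : MeasurableAlg nmaj nmin A) {K : ℕ} {w : Fin K → ℝ} (hw : ∀ j, |w j| ≤ 1)
    (S : Sample nmaj nmin) :
    risk (A S) (testMeasure (labelMeasure (fun _ => 1) true)
      (labelMeasure (perturbedDensity K w) false)) =
      (1 / 2) * (1 + ∑ j : Fin K, w j * bumpScore A K j S) := by
  have hT : MeasurableSet {x | A S x = true} :=
    hA.measurable_apply S (measurableSet_singleton true)
  rw [risk_testMeasure (continuous_perturbedDensity K w) (perturbedDensity_nonneg hw)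
    (integral_perturbedDensity w) (hA.measurable_apply S)]
  simp_rw [bumpScore, ← integral_const_mul]
  rw [← integral_finsetSum]
  · congr 2
    refine integral_congr_ae (Filter.Eventually.of_forall fun x => ?_)
    by_cases h : A S x = true <;> simp [h, perturbedDensity, perturbation]
  · intro j _
    exact (((integrableOn_of_continuous (continuous_binBump K j)).indicator hT).congr
      (Filter.Eventually.of_forall fun x => by simp [indicator])).const_mul _

theorem le_excessRisk_perturbed {nmaj nmin : ℕ} {A : Sample nmaj nmin → ℝ → Bool}
    (hA : MeasurableAlg nmaj nmin A) {K : ℕ} (hK : 0 < K) {w : Fin K → ℝ}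
    (hw : ∀ j, |w j| = 1) :
    (1 / 2) * (1 / (42 * K) +
        ∑ j : Fin K, w j * ∫ S, bumpScore A K j S ∂perturbedSample K nmaj nmin w) ≤
      excessRisk nmaj nmin A (labelMeasure (fun _ => 1) true)
        (labelMeasure (perturbedDensity K w) false) := by
  have hw' : ∀ j, |w j| ≤ 1 := fun j => (hw j).le
  have := isProbabilityMeasure_perturbedSample nmaj nmin hw'
  have hi : ∀ j : Fin K, Integrable (fun S => w j * bumpScore A K j S)
      (perturbedSample K nmaj nmin w) :=
    fun j => (integrable_bumpScore hA j.isLt _).const_mul _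
  have hb := bayesRisk_perturbed_le hK hw
  unfold excessRisk
  simp_rw [risk_perturbed hA hw']
  rw [← perturbedSample, integral_const_mul, integral_add (integrable_const 1)
    (integrable_finsetSum _ fun j _ => hi j), integral_finsetSum _ fun j _ => hi j]
  simp_rw [integral_const_mul]
  simp only [integral_const, probReal_univ, smul_eq_mul, one_mul]
  linarith

theorem one_add_pow_le {K n : ℕ} (hK : 0 < K) (hn : n ≤ K ^ 3) :
    (1 + 1 / (210 * (K:ℝ) ^ 3)) ^ n ≤ 1 + 1 / 105 := by
  have hKr : (0:ℝ) < K := by exact_mod_cast hK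
  have hn' : (n:ℝ) ≤ (K:ℝ) ^ 3 := by exact_mod_cast hn
  have hexp : Real.exp (1 / 210) ≤ 1 + 1 / 105 := by
    have h := Real.abs_exp_sub_one_le (x := 1 / 210) (by rw [abs_of_nonneg] <;> norm_num)
    rw [abs_of_nonneg (by norm_num : (0:ℝ) ≤ 1 / 210)] at h
    linarith [(abs_le.1 h).2]
  calc (1 + 1 / (210 * (K:ℝ) ^ 3)) ^ n
      ≤ Real.exp (1 / (210 * (K:ℝ) ^ 3)) ^ n := by
        gcongr
        rw [add_comm]
        exact Real.add_one_le_exp _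
    _ = Real.exp (n * (1 / (210 * (K:ℝ) ^ 3))) := (Real.exp_nat_mul _ _).symm
    _ ≤ Real.exp (1 / 210) := by
        apply Real.exp_le_exp.2
        rw [mul_one_div, div_le_div_iff₀ (by positivity) (by norm_num)]
        linarith
    _ ≤ _ := hexp

/-- The mean of the `j`-th score depends only weakly on the `j`-th amplitude. -/
theorem abs_integral_bumpScore_sub_le {nmaj nmin : ℕ} {A : Sample nmaj nmin → ℝ → Bool}
    (hA : MeasurableAlg nmaj nmin A) {K : ℕ} (hK : 0 < K) (hn : nmin ≤ K ^ 3)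
    {w : Fin K → ℝ} (hw : ∀ j, |w j| = 1) (j : Fin K) :
    |(∫ S, bumpScore A K j S ∂perturbedSample K nmaj nmin w) -
      ∫ S, bumpScore A K j S ∂perturbedSample K nmaj nmin (Function.update w j 0)| ≤
      1 / (10 * (K:ℝ) ^ 2) * ((1 / 10 + 1 / 105 / (1 / 10)) / 2) := by
  have hw' : ∀ j, |w j| ≤ 1 := fun j => (hw j).le
  have hw0 : ∀ i, |Function.update w j 0 i| ≤ 1 := by
    intro i
    rcases eq_or_ne i j with rfl | h
    · simp
    · rw [Function.update_of_ne h]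
      exact hw' i
  have hprob := isProbabilityMeasure_perturbed hw0
  have hc := continuous_binBump K j
  have hsmall : ∀ x, |w j * binBump K j x| ≤ 1 := by
    intro x
    rw [abs_mul, hw, one_mul]
    refine (abs_binBump_le K j x).trans ?_
    have : (1:ℝ) ≤ K := by exact_mod_cast hK
    rw [div_le_one (by positivity)]
    linarith
  have hdens0 : Measurable (perturbedDensity K (Function.update w j 0)) :=
    (continuous_perturbedDensity K _).measurable
  have hnn0 := perturbedDensity_nonneg hw0
  have hqm : Measurable fun z : ℝ × Bool => 1 + w j * binBump K j z.1 := by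
    have := hc.measurable
    fun_prop
  have hq1 : ∫ z, (1 + w j * binBump K j z.1)
      ∂labelMeasure (perturbedDensity K (Function.update w j 0)) false = 1 := by
    rw [integral_labelMeasure hdens0 hnn0 _ hqm]
    simp_rw [← perturbedDensity_eq_update_mul]
    exact integral_perturbedDensity w
  have hq2 : ∫ z, (1 + w j * binBump K j z.1) ^ 2
      ∂labelMeasure (perturbedDensity K (Function.update w j 0)) false =
      1 + 1 / (210 * (K:ℝ) ^ 3) := by
    have hwj : w j ^ 2 = 1 := by rw [← sq_abs, hw, one_pow]
    rw [integral_labelMeasure hdens0 hnn0 _ (hqm.pow_const 2)]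
    have : ∀ x, perturbedDensity K (Function.update w j 0) x * (1 + w j * binBump K j x) ^ 2 =
        perturbedDensity K w x + (w j * binBump K j x + binBump K j x ^ 2) := by
      intro x
      rw [sq, ← mul_assoc, ← perturbedDensity_eq_update_mul, mul_add, mul_one,
        perturbedDensity]
      have := perturbation_mul_binBump w j x
      linear_combination w j * this + binBump K j x ^ 2 * hwj
    simp_rw [this]
    rw [integral_add (integrableOn_of_continuous (continuous_perturbedDensity K w))
      (integrableOn_of_continuous (by fun_prop)), integral_perturbedDensity,
      integral_add (integrableOn_of_continuous (by fun_prop))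
      (integrableOn_of_continuous (by fun_prop)), integral_const_mul, integral_binBump j.isLt,
      integral_binBump_sq j.isLt]
    ring
  have htilt : labelMeasure (perturbedDensity K w) false =
      (labelMeasure (perturbedDensity K (Function.update w j 0)) false).withDensity
        fun z => ENNReal.ofReal (1 + w j * binBump K j z.1) := by
    rw [← labelMeasure_mul (g := fun x => 1 + w j * binBump K j x) hdens0 hnn0
      (by have := hc.measurable; fun_prop)]
    congr 1
    exact funext fun x => perturbedDensity_eq_update_mul w j x
  unfold perturbedSample sampleMeasure
  rw [htilt]
  exact abs_integral_tilt_sub_le hqm (C := 2)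
    (fun z => by linarith [(abs_le.1 (hsmall z.1)).1])
    (fun z => by linarith [(abs_le.1 (hsmall z.1)).2]) hq1
    (by rw [hq2]; exact one_add_pow_le hK hn) (measurable_bumpScore hA K j)
    (abs_bumpScore_le A j.isLt) (by norm_num)

/-- Assouad's averaging argument: averaged over all sign vectors, the signed scores are small. -/
theorem neg_le_sum_signed_scores {nmaj nmin : ℕ} {A : Sample nmaj nmin → ℝ → Bool}
    (hA : MeasurableAlg nmaj nmin A) {K : ℕ} (hK : 0 < K) (hn : nmin ≤ K ^ 3) (j : Fin K) :
    -((2:ℝ) ^ K * (1 / (100 * (K:ℝ) ^ 2))) ≤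
      ∑ v : Fin K → Bool, sgnB (v j) *
        ∫ S, bumpScore A K j S ∂perturbedSample K nmaj nmin fun i => sgnB (v i) := by
  have hsgn : ∀ b, |sgnB b| = 1 := by intro b; cases b <;> simp [sgnB]
  set c : (Fin K → Bool) → ℝ := fun v => ∫ S, bumpScore A K j S
    ∂perturbedSample K nmaj nmin (Function.update (fun i => sgnB (v i)) j 0) with hc
  have hzero : ∑ v : Fin K → Bool, sgnB (v j) * c v = 0 := by
    refine Finset.sum_involution (fun v _ => Function.update v j (!v j)) ?_ ?_ ?_ ?_
    · intro v _
      have h1 : c (Function.update v j (!v j)) = c v := by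
        simp only [hc]
        congr 2
        funext i
        rcases eq_or_ne i j with rfl | h
        · simp
        · simp [Function.update_of_ne h]
      rw [h1, Function.update_self]
      cases v j <;> simp [sgnB]
    · intro v _ _ h
      have := congrFun h j
      simp at this
    · intro v _
      exact Finset.mem_univ _
    · intro v _
      simp
  have hterm : ∀ v : Fin K → Bool, sgnB (v j) * c v - 1 / (100 * (K:ℝ) ^ 2) ≤ sgnB (v j) *
      ∫ S, bumpScore A K j S ∂perturbedSample K nmaj nmin fun i => sgnB (v i) := by
    intro v
    have h := abs_integral_bumpScore_sub_le (nmaj := nmaj) hA hK hn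
      (w := fun i => sgnB (v i)) (fun i => hsgn _) j
    have hle : 1 / (10 * (K:ℝ) ^ 2) * ((1 / 10 + 1 / 105 / (1 / 10)) / 2) ≤
        1 / (100 * (K:ℝ) ^ 2) := by
      rw [show 1 / (100 * (K:ℝ) ^ 2) = 1 / (10 * (K:ℝ) ^ 2) * (1 / 10) by
        rw [one_div_mul_one_div]; ring]
      exact mul_le_mul_of_nonneg_left (by norm_num) (by positivity)
    have h2 := h.trans hle
    rw [← one_mul |_ - _|, ← hsgn (v j), ← abs_mul, mul_sub] at h2
    rw [hsgn] at h2
    simp only [hc]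
    linarith [(abs_le.1 h2).1]
  have hsum := Finset.sum_le_sum fun v (_ : v ∈ Finset.univ) => hterm v
  rw [Finset.sum_sub_distrib, hzero, Finset.sum_const, Finset.card_univ, Fintype.card_fun,
    Fintype.card_bool, Fintype.card_fin, nsmul_eq_mul] at hsum
  push_cast at hsum
  linarith

theorem exists_le_excessRisk {nmaj nmin : ℕ} {A : Sample nmaj nmin → ℝ → Bool}
    (hA : MeasurableAlg nmaj nmin A) {K : ℕ} (hK : 0 < K) (hn : nmin ≤ K ^ 3) :
    ∃ P : {P : Measure (ℝ × Bool) × Measure (ℝ × Bool) // memLS P.1 P.2},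
      1 / (300 * (K:ℝ)) ≤ excessRisk nmaj nmin A P.1.1 P.1.2 := by
  have hsgn : ∀ b, |sgnB b| = 1 := by intro b; cases b <;> simp [sgnB]
  have hKr : (0:ℝ) < K := by exact_mod_cast hK
  by_contra! hcon
  have hv : ∀ v : Fin K → Bool, (1 / 2) * (1 / (42 * K) + ∑ j : Fin K, sgnB (v j) *
      ∫ S, bumpScore A K j S ∂perturbedSample K nmaj nmin fun i => sgnB (v i)) <
      1 / (300 * (K:ℝ)) := fun v =>
    (le_excessRisk_perturbed hA hK fun j => hsgn (v j)).trans_lt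
      (hcon ⟨(_, _), memLS_perturbed fun j => (hsgn (v j)).le⟩)
  have hsum := Finset.sum_le_sum fun v (_ : v ∈ Finset.univ) => (hv v).le
  rw [← Finset.mul_sum, Finset.sum_add_distrib, Finset.sum_comm] at hsum
  have hlow := Finset.sum_le_sum fun j (_ : j ∈ Finset.univ) =>
    neg_le_sum_signed_scores (nmaj := nmaj) hA hK hn j
  simp only [Finset.sum_const, Finset.card_univ, Fintype.card_fun, Fintype.card_bool,
    Fintype.card_fin, nsmul_eq_mul, Nat.cast_pow, Nat.cast_ofNat] at hsum hlow
  have h2 : (0:ℝ) < 2 ^ K / K := by positivity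
  have e1 : (2:ℝ) ^ K * (1 / (42 * K)) = 2 ^ K / K * (1 / 42) := by field_simp
  have e2 : (2:ℝ) ^ K * (1 / (300 * K)) = 2 ^ K / K * (1 / 300) := by field_simp
  have e3 : (K:ℝ) * -((2:ℝ) ^ K * (1 / (100 * (K:ℝ) ^ 2))) = - (2 ^ K / K * (1 / 100)) := by
    field_simp
  rw [e1, e2] at hsum
  rw [e3] at hlow
  linarith

theorem excessRisk_le_one {nmaj nmin : ℕ} (A : Sample nmaj nmin → ℝ → Bool)
    {Pmaj Pmin : Measure (ℝ × Bool)} (h : memLS Pmaj Pmin) :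
    excessRisk nmaj nmin A Pmaj Pmin ≤ 1 := by
  obtain ⟨p, q, hp0, hq0, -, -, hp1, hq1, rfl, rfl⟩ := h
  have h1 := isProbabilityMeasure_labelMeasure hp0 hp1 true
  have h2 := isProbabilityMeasure_labelMeasure hq0 hq1 false
  have : IsProbabilityMeasure (testMeasure (labelMeasure p true) (labelMeasure q false)) := by
    constructor
    simp [testMeasure, ENNReal.inv_two_add_inv_two]
  have : IsProbabilityMeasure
      (sampleMeasure nmaj nmin (labelMeasure p true) (labelMeasure q false)) := by
    unfold sampleMeasure
    infer_instance
  have hint := norm_integral_le_of_norm_le_const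
    (μ := sampleMeasure nmaj nmin (labelMeasure p true) (labelMeasure q false))
    (f := fun S => risk (A S) (testMeasure (labelMeasure p true) (labelMeasure q false)))
    (C := 1) (Filter.Eventually.of_forall fun S => by
      rw [risk, Real.norm_of_nonneg ENNReal.toReal_nonneg]
      exact measureReal_le_one)
  rw [probReal_univ, mul_one] at hint
  unfold excessRisk
  linarith [le_of_abs_le hint,
    bayesRisk_nonneg (testMeasure (labelMeasure p true) (labelMeasure q false))]

/-- **Theorem (label shift minimax lower bound).** For `n_min ≥ 1` and `n_maj > n_min`,
every measurable algorithm has worst-case excess risk over `𝒫_LS` at least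
`(1/600) · n_min^{-1/3}`; i.e. the minimax excess risk over `𝒫_LS` is at least
`(1/600) · (1/n_min^{1/3})`. -/
theorem label_shift_minimax_lower_bound
    (nmaj nmin : ℕ) (hmin : 1 ≤ nmin) (hmaj : nmin < nmaj)
    (A : Sample nmaj nmin → ℝ → Bool) (hA : MeasurableAlg nmaj nmin A) :
    (1/600) * (1 / (nmin : ℝ) ^ ((1:ℝ)/3)) ≤
      ⨆ P : {P : Measure (ℝ × Bool) × Measure (ℝ × Bool) // memLS P.1 P.2},
        excessRisk nmaj nmin A P.1.1 P.1.2 := by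
  have hn : (1:ℝ) ≤ nmin := by exact_mod_cast hmin
  set r : ℝ := (nmin : ℝ) ^ ((1:ℝ)/3) with hr
  have hr1 : 1 ≤ r := Real.one_le_rpow hn (by norm_num)
  have hr3 : r ^ 3 = nmin := by
    rw [hr, ← Real.rpow_natCast, ← Real.rpow_mul (by linarith)]
    norm_num
  have hK : 0 < ⌈r⌉₊ := Nat.ceil_pos.2 (by linarith)
  have hnK : nmin ≤ ⌈r⌉₊ ^ 3 := by
    have h : (nmin : ℝ) ≤ (⌈r⌉₊ : ℝ) ^ 3 := by
      rw [← hr3]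
      gcongr
      exact Nat.le_ceil r
    exact_mod_cast h
  have hKle : (⌈r⌉₊ : ℝ) ≤ 2 * r := by
    linarith [Nat.ceil_lt_add_one (by linarith : 0 ≤ r)]
  have hKr : (0:ℝ) < ⌈r⌉₊ := by exact_mod_cast hK
  obtain ⟨P, hP⟩ := exists_le_excessRisk (nmaj := nmaj) hA hK hnK
  have hle : (1/600) * (1 / r) ≤ 1 / (300 * (⌈r⌉₊ : ℝ)) := by
    rw [one_div_mul_one_div]
    exact one_div_le_one_div_of_le (by positivity) (by linarith)
  exact (hle.trans hP).trans (le_ciSup (f := fun P : {P : Measure (ℝ × Bool) ×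
    Measure (ℝ × Bool) // memLS P.1 P.2} => excessRisk nmaj nmin A P.1.1 P.1.2)
    ⟨1, by rintro _ ⟨P, rfl⟩; exact excessRisk_le_one A P.2⟩ P)
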